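/- Let M₁, M₂ be models based on rooted finitely M₁-generated and finitely M₂-generated descriptive frames F₁=(W₁,R₁,P₁), F₂=(W₂,R₂,P₂) for K4.3 with roots x₁, x₂, and suppose M₁,x₁ ∼_σ M₂,x₂ for a signature σ. Let {b^j | j∈F} be the partition of W₁ into the σ-blocks of M₁, and for j∈F set β(b^j) := {y∈W₂ | t^σ_{M₂}(y) ∈ t^σ_{M₁}(b^j)}. Then for all j,k∈F: (a) t^σ_{M₁}(b^j) = t^σ_{M₂}(β(b^j)); (b) β(b^j) is a σ-block in M₂, and b^j is degenerate iff β(b^j) is degenerate; (c) {β(b^j) | j∈F} is a partition of W₂; (d) b^j ◁ b^k in F₁ iff β(b^j) ◁ β(b^k) in F₂; (e) b^j is definable in M₁ iff β(b^j) is definable in M₂. -/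

import Mathlib

/-! ## Modal formulas -/

inductive MF : Type
  | var : ℕ → MF
  | top : MF
  | bot : MF
  | neg : MF → MF
  | and : MF → MF → MF
  | dia : MF → MF
deriving DecidableEq

namespace MF

def or (φ ψ : MF) : MF := .neg (.and (.neg φ) (.neg ψ))
def imp (φ ψ : MF) : MF := MF.or (.neg φ) ψ
def box (φ : MF) : MF := .neg (.dia (.neg φ))
def diaPlus (φ : MF) : MF := MF.or φ (.dia φ)
def boxPlus (φ : MF) : MF := .and φ (box φ)

/-- the propositional variables occurring in a formula -/
def vars : MF → Finset ℕ
  | .var p => {p}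
  | .top => ∅
  | .bot => ∅
  | .neg φ => vars φ
  | .and φ ψ => vars φ ∪ vars ψ
  | .dia φ => vars φ

/-- the signature of a formula -/
def sig (φ : MF) : Set ℕ := ↑(vars φ)

/-- subformulas -/
def subs : MF → Finset MF
  | .var p => {.var p}
  | .top => {.top}
  | .bot => {.bot}
  | .neg φ => insert (.neg φ) (subs φ)
  | .and φ ψ => insert (.and φ ψ) (subs φ ∪ subs ψ)
  | .dia φ => insert (.dia φ) (subs φ)

/-- `|φ|`: the number of subformulas of `φ` together with their negations -/
def size (φ : MF) : ℕ := ((subs φ) ∪ (subs φ).image MF.neg).card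

/-- uniform substitution -/
def substVar (s : ℕ → MF) : MF → MF
  | .var p => s p
  | .top => .top
  | .bot => .bot
  | .neg φ => .neg (substVar s φ)
  | .and φ ψ => .and (substVar s φ) (substVar s ψ)
  | .dia φ => .dia (substVar s φ)

end MF

/-- a Boolean evaluation of modal formulas (treating `◇`-formulas and variables as atoms) -/
def BoolEval (f : MF → Prop) : Prop :=
  f .top ∧ ¬ f .bot ∧ (∀ φ, f (.neg φ) ↔ ¬ f φ) ∧ (∀ φ ψ, f (.and φ ψ) ↔ (f φ ∧ f ψ))

/-- Boolean tautologies in the modal language -/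
def MF.Tautology (φ : MF) : Prop := ∀ f : MF → Prop, BoolEval f → f φ

/-- normal modal logics -/
structure IsNormalLogic (L : Set MF) : Prop where
  taut : ∀ φ, φ.Tautology → φ ∈ L
  axK : MF.imp (MF.box (MF.imp (.var 0) (.var 1)))
          (MF.imp (MF.box (.var 0)) (MF.box (.var 1))) ∈ L
  mp : ∀ φ ψ, φ ∈ L → MF.imp φ ψ ∈ L → ψ ∈ L
  subst : ∀ φ s, φ ∈ L → MF.substVar s φ ∈ L
  nec : ∀ φ, φ ∈ L → MF.box φ ∈ L

/-- the smallest normal modal logic containing `Γ` -/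
def NormClosure (Γ : Set MF) : Set MF :=
  {φ | ∀ L : Set MF, IsNormalLogic L → Γ ⊆ L → φ ∈ L}

def ax4 : MF := MF.imp (MF.box (.var 0)) (MF.box (MF.box (.var 0)))
def ax43 : MF := MF.or (MF.box (MF.imp (MF.boxPlus (.var 0)) (.var 1)))
                       (MF.box (MF.imp (MF.boxPlus (.var 1)) (.var 0)))
def axGL : MF := MF.imp (MF.box (MF.imp (MF.box (.var 0)) (.var 0))) (MF.box (.var 0))

def K4 : Set MF := NormClosure {ax4}
def K43 : Set MF := NormClosure {ax4, ax43}
def GL3 : Set MF := NormClosure {ax4, ax43, axGL}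

/-! ## General frames and models -/

/-- a (general) frame: a relation together with a collection of "internal" sets -/
structure KFrame (W : Type) where
  R : W → W → Prop
  P : Set (Set W)

namespace KFrame

variable {W : Type}

def dia (F : KFrame W) (X : Set W) : Set W := {x | ∃ y ∈ X, F.R x y}

/-- the conditions making `F` a general frame -/
def IsGeneral (F : KFrame W) : Prop :=
  Nonempty W ∧ ∅ ∈ F.P ∧ Set.univ ∈ F.P ∧
    (∀ X ∈ F.P, ∀ Y ∈ F.P, X ∩ Y ∈ F.P) ∧
    (∀ X ∈ F.P, Xᶜ ∈ F.P) ∧ (∀ X ∈ F.P, F.dia X ∈ F.P)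

/-- differentiated, tight and compact -/
def Descriptive (F : KFrame W) : Prop :=
  (∀ x y : W, (∀ X ∈ F.P, x ∈ X ↔ y ∈ X) → x = y) ∧
  (∀ x y : W, F.R x y ↔ ∀ X ∈ F.P, y ∈ X → x ∈ F.dia X) ∧
  (∀ 𝒳 : Set (Set W), 𝒳 ⊆ F.P →
    (∀ 𝒴 : Set (Set W), 𝒴 ⊆ 𝒳 → 𝒴.Finite → (⋂₀ 𝒴).Nonempty) → (⋂₀ 𝒳).Nonempty)

/-- `x` is a root of `F` (every point is reachable from `x` via the reflexive closure) -/
def Rooted (F : KFrame W) (x : W) : Prop := ∀ y : W, x = y ∨ F.R x y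

/-- the strict order on clusters: `C(x) <_R C(y)` -/
def clLT (F : KFrame W) (x y : W) : Prop := F.R x y ∧ ¬ F.R y x

/-- the cluster of a point -/
def cluster (F : KFrame W) (x : W) : Set W := insert x {y | F.R x y ∧ F.R y x}

def clLE (F : KFrame W) (x y : W) : Prop := y ∈ F.cluster x ∨ F.clLT x y

/-- the closed interval of clusters `[C(x), C(y)]` -/
def interval (F : KFrame W) (x y : W) : Set W := {z | F.clLE x z ∧ F.clLE z y}

/-- `C(x)` is the final cluster -/
def FinalCl (F : KFrame W) (x : W) : Prop := ∀ y, ¬ F.clLT x y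

/-- `C(y)` is an immediate successor of `C(x)` -/
def ImmSucc (F : KFrame W) (x y : W) : Prop :=
  F.clLT x y ∧ ¬ ∃ z, F.clLT x z ∧ F.clLT z y

/-- `C(x)` is a limit cluster -/
def LimitCl (F : KFrame W) (x : W) : Prop := ¬ F.FinalCl x ∧ ¬ ∃ y, F.ImmSucc x y

/-- `C(x)` is a degenerate cluster -/
def DegenerateCl (F : KFrame W) (x : W) : Prop := ¬ F.R x x

end KFrame

/-- the closure of a family of sets under `∩`, complement and `◇` -/
inductive genBy {W : Type} (R : W → W → Prop) (G : Set (Set W)) : Set W → Prop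
  | basic {X : Set W} : X ∈ G → genBy R G X
  | empty : genBy R G ∅
  | univ : genBy R G Set.univ
  | inter {X Y : Set W} : genBy R G X → genBy R G Y → genBy R G (X ∩ Y)
  | compl {X : Set W} : genBy R G X → genBy R G Xᶜ
  | dia {X : Set W} : genBy R G X → genBy R G {x | ∃ y ∈ X, R x y}

def KFrame.GeneratedBy {W : Type} (F : KFrame W) (G : Set (Set W)) : Prop :=
  F.P = {X | genBy F.R G X}

def KFrame.FinGenerated {W : Type} (F : KFrame W) : Prop :=
  ∃ G : Set (Set W), G.Finite ∧ F.GeneratedBy G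

def KFrame.NGenerated {W : Type} (F : KFrame W) (n : ℕ) : Prop :=
  ∃ G : Set (Set W), G.Finite ∧ G.ncard = n ∧ F.GeneratedBy G

/-- a model: a frame with a valuation -/
structure KModel (W : Type) where
  F : KFrame W
  v : ℕ → Set W

namespace KModel

variable {W : Type}

/-- the frame is a general frame and all values of the valuation are internal -/
def IsModel (M : KModel W) : Prop := M.F.IsGeneral ∧ ∀ p, M.v p ∈ M.F.P

/-- truth at a point -/
def sat (M : KModel W) : W → MF → Prop
  | x, .var p => x ∈ M.v p
  | _, .top => True
  | _, .bot => False
  | x, .neg φ => ¬ sat M x φ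
  | x, .and φ ψ => sat M x φ ∧ sat M x ψ
  | x, .dia φ => ∃ y, M.F.R x y ∧ sat M y φ

/-- a set is definable in `M` -/
def Definable (M : KModel W) (X : Set W) : Prop := ∃ φ : MF, X = {x | M.sat x φ}

/-- every internal set is definable in `M` -/
def MGenerated (M : KModel W) : Prop := ∀ X ∈ M.F.P, M.Definable X

/-- finitely `M`-generated -/
def FinMGenerated (M : KModel W) : Prop := M.MGenerated ∧ M.F.FinGenerated

/-- the σ-type of a point: all σ-formulas true at it -/
def stype (M : KModel W) (σ : Set ℕ) (x : W) : Set MF := {φ | φ.sig ⊆ σ ∧ M.sat x φ}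

/-- `x` is `Γ`-maximal in `M` -/
def MaxFor (M : KModel W) (Γ : Set MF) (x : W) : Prop :=
  (∀ γ ∈ Γ, M.sat x γ) ∧ ∀ y, M.F.R x y → (∀ γ ∈ Γ, M.sat y γ) → M.F.R y x

/-- the cluster `C(x)` is `μ`-maximal in `M` -/
def ClMuMax (M : KModel W) (μ : MF) (x : W) : Prop := ∃ z ∈ M.F.cluster x, M.MaxFor {μ} z

/-- the cluster `C(x)` is maximal in `M` -/
def ClMax (M : KModel W) (x : W) : Prop := ∃ μ : MF, M.ClMuMax μ x

/-- the cluster `C(x)` is σ-maximal in `M` -/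
def ClSigMax (M : KModel W) (σ : Set ℕ) (x : W) : Prop :=
  ∃ μ : MF, μ.sig ⊆ σ ∧ M.ClMuMax μ x

/-- the cluster `C(x)` is definable in `M` -/
def ClDefinable (M : KModel W) (x : W) : Prop := M.Definable (M.F.cluster x)

/-- `◇ t^σ_M(x) ⊆ t^σ_M(y)` -/
def diaSubset (M : KModel W) (σ : Set ℕ) (x y : W) : Prop :=
  ∀ φ ∈ M.stype σ x, MF.dia φ ∈ M.stype σ y

/-- the σ-block of a point -/
def sblockOf (M : KModel W) (σ : Set ℕ) (x : W) : Set W :=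
  {y | (M.diaSubset σ x x ∧ M.diaSubset σ y x ∧ M.diaSubset σ x y) ∨
       (¬ M.diaSubset σ x x ∧ y = x)}

/-- a σ-block in `M` -/
def IsSBlock (M : KModel W) (σ : Set ℕ) (b : Set W) : Prop := ∃ x, b = M.sblockOf σ x

/-- a degenerate σ-block in `M` -/
def DegenSBlock (M : KModel W) (σ : Set ℕ) (b : Set W) : Prop :=
  ∃ x, b = M.sblockOf σ x ∧ ¬ M.diaSubset σ x x

end KModel

/-- validity of a formula on a frame -/
def KFrame.Valid {W : Type} (F : KFrame W) (φ : MF) : Prop :=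
  ∀ v : ℕ → Set W, (∀ p, v p ∈ F.P) → ∀ x, (KModel.mk F v).sat x φ

/-- `F` is a frame for the logic `L` -/
def KFrame.IsFrameFor {W : Type} (F : KFrame W) (L : Set MF) : Prop :=
  ∀ φ ∈ L, F.Valid φ

/-! ## Bisimulations -/

def IsBisim {W₁ W₂ : Type} (σ : Set ℕ) (M₁ : KModel W₁) (M₂ : KModel W₂)
    (β : W₁ → W₂ → Prop) : Prop :=
  ∀ x₁ x₂, β x₁ x₂ →
    (∀ p ∈ σ, x₁ ∈ M₁.v p ↔ x₂ ∈ M₂.v p) ∧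
    (∀ y₁, M₁.F.R x₁ y₁ → ∃ y₂, M₂.F.R x₂ y₂ ∧ β y₁ y₂) ∧
    (∀ y₂, M₂.F.R x₂ y₂ → ∃ y₁, M₁.F.R x₁ y₁ ∧ β y₁ y₂)

def Bisimilar {W₁ W₂ : Type} (σ : Set ℕ) (M₁ : KModel W₁) (x₁ : W₁)
    (M₂ : KModel W₂) (x₂ : W₂) : Prop :=
  ∃ β, IsBisim σ M₁ M₂ β ∧ β x₁ x₂

/-- the two points satisfy the same variables of `σ` -/
def SigAgree {W₁ W₂ : Type} (σ : Set ℕ) (M₁ : KModel W₁) (x₁ : W₁)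
    (M₂ : KModel W₂) (x₂ : W₂) : Prop :=
  ∀ p ∈ σ, x₁ ∈ M₁.v p ↔ x₂ ∈ M₂.v p

/-- the two points have the same σ-type -/
def TypeEquiv {W₁ W₂ : Type} (σ : Set ℕ) (M₁ : KModel W₁) (x₁ : W₁)
    (M₂ : KModel W₂) (x₂ : W₂) : Prop :=
  ∀ φ : MF, φ.sig ⊆ σ → (M₁.sat x₁ φ ↔ M₂.sat x₂ φ)

/-! ## Interpolants -/

def IsInterpolant (L : Set MF) (φ₁ φ₂ ι : MF) : Prop :=
  ι.sig ⊆ φ₁.sig ∩ φ₂.sig ∧ MF.imp φ₁ ι ∈ L ∧ MF.imp ι φ₂ ∈ L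

def NoInterpolant (L : Set MF) (φ₁ φ₂ : MF) : Prop := ¬ ∃ ι, IsInterpolant L φ₁ φ₂ ι

def HasCIP (L : Set MF) : Prop :=
  ∀ φ₁ φ₂ : MF, MF.imp φ₁ φ₂ ∈ L → ∃ ι, IsInterpolant L φ₁ φ₂ ι

/-- `k(φ₁,φ₂) = 3 + 3·max(|φ₁|,|φ₂|)` -/
def kBound (φ₁ φ₂ : MF) : ℕ := 3 + 3 * max φ₁.size φ₂.size

/-- the conjunction of a finite list of formulas -/
def conjList : List MF → MF
  | [] => .top
  | φ :: l => .and φ (conjList l)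

/-! ## d-persistence and cofinal subframe logics -/

def DPersistent (L : Set MF) : Prop :=
  ∀ (W : Type) (F : KFrame W), F.IsGeneral → F.Descriptive → F.IsFrameFor L →
    KFrame.IsFrameFor ⟨F.R, (Set.univ : Set (Set W))⟩ L

def CofinalSet {W : Type} (F : KFrame W) (S : Set W) : Prop :=
  ∀ x ∈ S, ∀ y, F.R x y → y ∈ S ∨ ∃ z ∈ S, F.R y z

/-- the subframe of `F` with underlying set `S` and internal sets `Q` -/
def subframeOn {W : Type} (F : KFrame W) (S : Set W) (Q : Set (Set W)) : KFrame S :=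
  ⟨fun a b => F.R a.1 b.1, {T | ∃ X ∈ Q, T = (Subtype.val ⁻¹' X : Set S)}⟩

/-- the class of general frames of `L` is closed under cofinal subframes -/
def CofinalSubframeLogic (L : Set MF) : Prop :=
  ∀ (W : Type) (F : KFrame W) (S : Set W) (Q : Set (Set W)),
    F.IsGeneral → F.IsFrameFor L → Q ⊆ F.P → (∀ X ∈ Q, X ⊆ S) →
    (subframeOn F S Q).IsGeneral → CofinalSet F S →
    (subframeOn F S Q).IsFrameFor L

/-- the subframe of `F` generated by a point `x` -/
def KFrame.genSub {W : Type} (F : KFrame W) (x : W) :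
    KFrame {y : W // x = y ∨ F.R x y} :=
  ⟨fun a b => F.R a.1 b.1, {S | ∃ X ∈ F.P, S = Subtype.val ⁻¹' X}⟩

/-- the counterpart `β(b) = {y ∈ W₂ | t^σ_{M₂}(y) ∈ t^σ_{M₁}(b)}` of a σ-block -/
def blockImage {W₁ W₂ : Type} (σ : Set ℕ) (M₁ : KModel W₁) (M₂ : KModel W₂)
    (b : Set W₁) : Set W₂ :=
  {y | ∃ z ∈ b, M₂.stype σ y = M₁.stype σ z}

/-- `I ◁ I'` : the two sets are disjoint and every point of `I` sees every point of `I'` -/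
def SetBefore {W : Type} (F : KFrame W) (I I' : Set W) : Prop :=
  Disjoint I I' ∧ ∀ x ∈ I, ∀ y ∈ I', F.R x y

namespace KFrame

variable {W : Type} {F : KFrame W}

theorem trans_of_isFrameFor_K43 (hG : F.IsGeneral) (hd : F.Descriptive)
    (hK : F.IsFrameFor K43) {x y z : W} (hxy : F.R x y) (hyz : F.R y z) : F.R x z := by
  rw [hd.2.1]
  intro X hX hz
  by_contra hx
  have h := hK ax4 (fun L _ h => h (by simp)) (fun _ => Xᶜ) (fun _ => hG.2.2.2.2.1 X hX) x
  simp only [ax4, MF.imp, MF.or, MF.box, KModel.sat, Set.mem_compl_iff, not_not] at h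
  refine h ⟨?_, y, hxy, z, hyz, hz⟩
  rintro ⟨w, hw, hwX⟩
  exact hx ⟨w, hwX, hw⟩

theorem connected_of_isFrameFor_K43 (hG : F.IsGeneral) (hd : F.Descriptive)
    (hK : F.IsFrameFor K43) {x y z : W} (hxy : F.R x y) (hxz : F.R x z) :
    y = z ∨ F.R y z ∨ F.R z y := by
  obtain ⟨-, -, -, hinter, hcompl, -⟩ := hG
  by_contra! ⟨hne, hyz, hzy⟩
  obtain ⟨D, hD, hyD, hzD⟩ : ∃ D ∈ F.P, y ∈ D ∧ z ∉ D := by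
    by_contra! hcon
    refine hne (hd.1 y z fun X hX => ⟨hcon X hX, fun hz => ?_⟩)
    by_contra hy
    exact hcon Xᶜ (hcompl X hX) hy hz
  rw [hd.2.1] at hyz hzy
  push Not at hyz hzy
  obtain ⟨A, hA, hzA, hyA⟩ := hyz
  obtain ⟨B, hB, hyB, hzB⟩ := hzy
  have h := hK ax43 (fun L _ h => h (by simp))
    (fun n => if n = 0 then (A ∩ Dᶜ)ᶜ else (B ∩ D)ᶜ)
    (fun n => by
      split_ifs
      · exact hcompl _ (hinter _ hA _ (hcompl _ hD))
      · exact hcompl _ (hinter _ hB _ hD)) x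
  simp only [ax43, MF.imp, MF.or, MF.box, MF.boxPlus, KModel.sat, if_true, one_ne_zero,
    if_false, not_not, Set.mem_compl_iff] at h
  refine h ⟨⟨y, hxy, ⟨?_, ?_⟩, ?_⟩, ⟨z, hxz, ⟨?_, ?_⟩, ?_⟩⟩
  · exact fun h => h.2 hyD
  · rintro ⟨w, hw, hwA⟩
    exact hyA ⟨w, hwA.1, hw⟩
  · exact ⟨hyB, hyD⟩
  · exact fun h => hzD h.2
  · rintro ⟨w, hw, hwB⟩
    exact hzB ⟨w, hwB.1, hw⟩
  · exact ⟨hzA, hzD⟩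

theorem Rooted.connected {r : W} (hr : F.Rooted r) (hG : F.IsGeneral) (hd : F.Descriptive)
    (hK : F.IsFrameFor K43) (x y : W) : x = y ∨ F.R x y ∨ F.R y x := by
  rcases hr x with rfl | hx
  · exact (hr y).imp_right Or.inl
  · rcases hr y with rfl | hy
    · exact Or.inr (Or.inr hx)
    · exact connected_of_isFrameFor_K43 hG hd hK hx hy

end KFrame

/-- `◇s ⊆ t` for sets of formulas -/
def DiaSub (s t : Set MF) : Prop := ∀ φ ∈ s, MF.dia φ ∈ t

/-- two types are equal or mutually `◇`-accessible -/
def BlockEquiv (s t : Set MF) : Prop := s = t ∨ (DiaSub s t ∧ DiaSub t s)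

theorem BlockEquiv.symm {s t : Set MF} (h : BlockEquiv s t) : BlockEquiv t s :=
  h.imp Eq.symm And.symm

namespace KModel

variable {W : Type} {M : KModel W} {σ : Set ℕ}

theorem IsModel.sat_mem (hM : M.IsModel) (φ : MF) : {x | M.sat x φ} ∈ M.F.P := by
  obtain ⟨⟨-, hempty, huniv, hinter, hcompl, hdia⟩, hv⟩ := hM
  induction φ with
  | var p => exact hv p
  | top => exact huniv
  | bot => exact hempty
  | neg φ ih => exact hcompl _ ih
  | and φ ψ ih₁ ih₂ => exact hinter _ ih₁ _ ih₂
  | dia φ ih =>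
    convert hdia _ ih using 1
    ext x
    exact exists_congr fun y => and_comm

theorem sat_conjList {x : W} {l : List MF} :
    M.sat x (conjList l) ↔ ∀ φ ∈ l, M.sat x φ := by
  induction l with
  | nil => simp [conjList, sat]
  | cons φ l ih => simp [conjList, sat, ih]

theorem sig_conjList {l : List MF} (h : ∀ φ ∈ l, φ.sig ⊆ σ) : (conjList l).sig ⊆ σ := by
  induction l with
  | nil => simp [conjList, MF.sig, MF.vars]
  | cons φ l ih =>
    simp only [List.mem_cons, forall_eq_or_imp] at h
    simpa [conjList, MF.sig, MF.vars] using And.intro h.1 (ih h.2)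

theorem IsModel.exists_list_of_forall_not_sat (hM : M.IsModel) (hd : M.F.Descriptive)
    {X : Set W} (hX : X ∈ M.F.P) {Γ : Set MF} (h : ∀ x ∈ X, ∃ φ ∈ Γ, ¬ M.sat x φ) :
    ∃ l : List MF, (∀ φ ∈ l, φ ∈ Γ) ∧ ∀ x ∈ X, ¬ M.sat x (conjList l) := by
  by_contra! hcon
  obtain ⟨x, hx⟩ := hd.2.2 (insert X ((fun φ => {x | M.sat x φ}) '' Γ)) (by
    rintro _ (rfl | ⟨φ, -, rfl⟩)
    exacts [hX, hM.sat_mem φ]) (by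
    intro 𝒴 h𝒴 hfin
    have hsub : 𝒴 \ {X} ⊆ (fun φ => {x | M.sat x φ}) '' Γ := fun Y hY =>
      (h𝒴 hY.1).resolve_left hY.2
    obtain ⟨s, hs, hsfin, hseq⟩ := Set.exists_subset_image_finite_and
      (p := fun T => T = 𝒴 \ {X}) |>.1 ⟨_, hsub, hfin.sdiff, rfl⟩
    obtain ⟨x, hxX, hx⟩ := hcon hsfin.toFinset.toList (by simpa using fun φ hφ => hs hφ)
    rw [sat_conjList] at hx
    refine ⟨x, fun Y hY => ?_⟩
    by_cases hYX : Y = X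
    · exact hYX ▸ hxX
    · obtain ⟨φ, hφ, rfl⟩ : Y ∈ (fun φ => {x | M.sat x φ}) '' s := hseq ▸ ⟨hY, hYX⟩
      exact hx φ (by simpa using hφ))
  obtain ⟨φ, hφ, hn⟩ := h x (hx X (Set.mem_insert _ _))
  exact hn (hx _ (Set.mem_insert_of_mem _ ⟨φ, hφ, rfl⟩))

theorem exists_sat_not_sat_of_stype_ne {x y : W} (h : M.stype σ x ≠ M.stype σ y) :
    ∃ φ ∈ M.stype σ x, ¬ M.sat y φ := by
  by_contra! hcon
  refine h (Set.ext fun φ => ⟨fun hφ => ⟨hφ.1, hcon φ hφ⟩, fun hφ => ⟨hφ.1, ?_⟩⟩)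
  by_contra hx
  exact hcon (.neg φ) ⟨hφ.1, hx⟩ hφ.2

/-- a definable set that is a union of classes of points of equal `σ`-type is definable by a
`σ`-formula -/
theorem IsModel.exists_sig_formula (hM : M.IsModel) (hd : M.F.Descriptive) {X : Set W}
    (hX : M.Definable X) (hsat : ∀ x ∈ X, ∀ y, M.stype σ x = M.stype σ y → y ∈ X) :
    ∃ χ : MF, χ.sig ⊆ σ ∧ X = {x | M.sat x χ} := by
  have hXP : X ∈ M.F.P := by
    obtain ⟨φ, rfl⟩ := hX
    exact hM.sat_mem φ
  have hlocal : ∀ x ∈ X, ∃ φ : MF, φ.sig ⊆ σ ∧ M.sat x φ ∧ ∀ y ∈ Xᶜ, ¬ M.sat y φ := by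
    intro x hx
    obtain ⟨l, hl, hlX⟩ := hM.exists_list_of_forall_not_sat hd (hM.1.2.2.2.2.1 X hXP)
      (Γ := M.stype σ x) fun y hy => exists_sat_not_sat_of_stype_ne fun h => hy (hsat x hx y h)
    exact ⟨conjList l, sig_conjList fun φ hφ => (hl φ hφ).1,
      sat_conjList.2 fun φ hφ => (hl φ hφ).2, hlX⟩
  obtain ⟨l, hl, hlX⟩ := hM.exists_list_of_forall_not_sat hd hXP
    (Γ := {φ | φ.sig ⊆ σ ∧ ∀ y ∈ Xᶜ, M.sat y φ}) fun x hx => by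
      obtain ⟨φ, hφσ, hφx, hφ⟩ := hlocal x hx
      exact ⟨.neg φ, ⟨hφσ, hφ⟩, not_not.2 hφx⟩
  refine ⟨.neg (conjList l), sig_conjList (fun φ hφ => (hl φ hφ).1), Set.ext fun x =>
    ⟨hlX x, fun hx => ?_⟩⟩
  by_contra hxX
  exact hx (sat_conjList.2 fun φ hφ => (hl φ hφ).2 x hxX)

theorem diaSub_of_rel {x y : W} (h : M.F.R x y) : DiaSub (M.stype σ y) (M.stype σ x) :=
  fun _ hφ => ⟨hφ.1, y, h, hφ.2⟩

theorem diaSub_trans (htr : ∀ x y z, M.F.R x y → M.F.R y z → M.F.R x z) {s t : Set MF} {x : W}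
    (h₁ : DiaSub s t) (h₂ : DiaSub t (M.stype σ x)) : DiaSub s (M.stype σ x) := by
  intro φ hφ
  obtain ⟨hσ, y, hxy, z, hyz, hz⟩ := h₂ _ (h₁ φ hφ)
  exact ⟨hσ, z, htr _ _ _ hxy hyz, hz⟩

theorem sblockOf_eq (htr : ∀ x y z, M.F.R x y → M.F.R y z → M.F.R x z)
    (hconn : ∀ x y, x = y ∨ M.F.R x y ∨ M.F.R y x) (x : W) :
    M.sblockOf σ x = {y | BlockEquiv (M.stype σ y) (M.stype σ x)} := by
  ext y
  constructor
  · rintro (⟨-, h⟩ | ⟨-, rfl⟩)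
    exacts [Or.inr h, Or.inl rfl]
  · intro h
    by_cases hx : M.diaSubset σ x x
    · refine Or.inl ⟨hx, ?_⟩
      rcases h with h | h
      · change DiaSub (M.stype σ y) (M.stype σ x) ∧ DiaSub (M.stype σ x) (M.stype σ y)
        rw [h]
        exact ⟨hx, hx⟩
      · exact h
    · refine Or.inr ⟨hx, ?_⟩
      rcases h with h | h
      · rcases hconn y x with hyx | hyx | hxy
        · exact hyx
        · have hxx : DiaSub (M.stype σ x) (M.stype σ y) := diaSub_of_rel hyx
          rw [h] at hxx
          exact absurd hxx hx
        · have hxx : DiaSub (M.stype σ y) (M.stype σ x) := diaSub_of_rel hxy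
          rw [h] at hxx
          exact absurd hxx hx
      · exact absurd (diaSub_trans htr h.2 h.1) hx

theorem blockEquiv_trans (htr : ∀ x y z, M.F.R x y → M.F.R y z → M.F.R x z) {x y z : W}
    (h₁ : BlockEquiv (M.stype σ x) (M.stype σ y)) (h₂ : BlockEquiv (M.stype σ y) (M.stype σ z)) :
    BlockEquiv (M.stype σ x) (M.stype σ z) := by
  rcases h₁ with h₁ | ⟨h₁, h₁'⟩
  · rwa [h₁]
  · rcases h₂ with h₂ | ⟨h₂, h₂'⟩
    · exact Or.inr (h₂ ▸ ⟨h₁, h₁'⟩)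
    · exact Or.inr ⟨diaSub_trans htr h₁ h₂, diaSub_trans htr h₂' h₁'⟩

theorem setOf_blockEquiv_eq (htr : ∀ x y z, M.F.R x y → M.F.R y z → M.F.R x z) {x y z : W}
    (h₁ : BlockEquiv (M.stype σ y) (M.stype σ x)) (h₂ : BlockEquiv (M.stype σ y) (M.stype σ z)) :
    {w | BlockEquiv (M.stype σ w) (M.stype σ x)} =
      {w | BlockEquiv (M.stype σ w) (M.stype σ z)} :=
  Set.ext fun _ => ⟨fun h => blockEquiv_trans htr (blockEquiv_trans htr h h₁.symm) h₂,
    fun h => blockEquiv_trans htr (blockEquiv_trans htr h h₂.symm) h₁⟩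

end KModel

section Transfer

open KModel

variable {W₁ W₂ : Type} {M₁ : KModel W₁} {M₂ : KModel W₂} {σ : Set ℕ}

theorem IsBisim.sat_iff {β : W₁ → W₂ → Prop} (hβ : IsBisim σ M₁ M₂ β) (φ : MF)
    (hφ : φ.sig ⊆ σ) {x : W₁} {y : W₂} (h : β x y) : M₁.sat x φ ↔ M₂.sat y φ := by
  induction φ generalizing x y with
  | var p => exact (hβ x y h).1 p (hφ (by simp [MF.sig, MF.vars]))
  | top => exact Iff.rfl
  | bot => exact Iff.rfl
  | neg φ ih => exact not_congr (ih hφ h)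
  | and φ ψ ih₁ ih₂ =>
    simp only [MF.sig, MF.vars, Finset.coe_union, Set.union_subset_iff] at hφ
    exact and_congr (ih₁ hφ.1 h) (ih₂ hφ.2 h)
  | dia φ ih =>
    constructor
    · rintro ⟨z, hz, hs⟩
      obtain ⟨w, hw, hzw⟩ := (hβ x y h).2.1 z hz
      exact ⟨w, hw, (ih hφ hzw).1 hs⟩
    · rintro ⟨w, hw, hs⟩
      obtain ⟨z, hz, hzw⟩ := (hβ x y h).2.2 w hw
      exact ⟨z, hz, (ih hφ hzw).2 hs⟩

theorem IsBisim.stype_eq {β : W₁ → W₂ → Prop} (hβ : IsBisim σ M₁ M₂ β) {x : W₁} {y : W₂}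
    (h : β x y) : M₁.stype σ x = M₂.stype σ y :=
  Set.ext fun φ => and_congr_right fun hφ => hβ.sat_iff φ hφ h

/-- definability transfers between sets cut out by the same set of realized types -/
theorem definable_transfer (hM₁ : M₁.IsModel) (hd₁ : M₁.F.Descriptive)
    (h₂₁ : ∀ y, ∃ x, M₁.stype σ x = M₂.stype σ y) (S : Set (Set MF))
    (h : M₁.Definable {x | M₁.stype σ x ∈ S}) : M₂.Definable {y | M₂.stype σ y ∈ S} := by
  obtain ⟨χ, hχσ, hχ⟩ := hM₁.exists_sig_formula (σ := σ) hd₁ h fun x hx y hxy => by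
    rwa [Set.mem_ofPred_eq, ← hxy]
  refine ⟨χ, Set.ext fun y => ?_⟩
  obtain ⟨x, hx⟩ := h₂₁ y
  have hiff : M₁.stype σ x ∈ S ↔ M₁.sat x χ := Set.ext_iff.1 hχ x
  have hsat : χ ∈ M₁.stype σ x ↔ χ ∈ M₂.stype σ y := by rw [hx]
  rw [Set.mem_ofPred_eq, ← hx, hiff]
  exact ⟨fun h => (hsat.1 ⟨hχσ, h⟩).2, fun h => (hsat.2 ⟨hχσ, h⟩).2⟩

/-- the order `◁` transfers between blocks cut out by the same types -/
theorem setBefore_transfer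
    (h₂₁ : ∀ y, ∃ x, M₁.stype σ x = M₂.stype σ y)
    (htr : ∀ x y z, M₁.F.R x y → M₁.F.R y z → M₁.F.R x z)
    (hconn : ∀ x y, x = y ∨ M₂.F.R x y ∨ M₂.F.R y x) {s t : W₁}
    (h : SetBefore M₁.F {x | BlockEquiv (M₁.stype σ x) (M₁.stype σ s)}
      {x | BlockEquiv (M₁.stype σ x) (M₁.stype σ t)}) :
    SetBefore M₂.F {y | BlockEquiv (M₂.stype σ y) (M₁.stype σ s)}
      {y | BlockEquiv (M₂.stype σ y) (M₁.stype σ t)} := by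
  obtain ⟨hdis, hrel⟩ := h
  rw [Set.disjoint_left] at hdis
  have hdis' : Disjoint {y | BlockEquiv (M₂.stype σ y) (M₁.stype σ s)}
      {y | BlockEquiv (M₂.stype σ y) (M₁.stype σ t)} := by
    rw [Set.disjoint_left]
    intro y
    obtain ⟨x, hx⟩ := h₂₁ y
    have := @hdis x
    simp only [Set.mem_ofPred_eq] at this ⊢
    rwa [← hx]
  refine ⟨hdis', fun u hu w hw => ?_⟩
  rcases hconn u w with rfl | huw | hwu
  · exact absurd hw (Set.disjoint_left.1 hdis' hu)
  · exact huw
  · exfalso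
    have hst : M₁.F.R s t := hrel s (Or.inl rfl) t (Or.inl rfl)
    have hts : DiaSub (M₁.stype σ s) (M₁.stype σ t) := by
      have h₁ : DiaSub (M₂.stype σ u) (M₂.stype σ w) := diaSub_of_rel hwu
      obtain ⟨x, hx⟩ := h₂₁ w
      simp only [Set.mem_ofPred_eq] at hu hw
      rw [← hx] at h₁ hw
      have h₂ : DiaSub (M₁.stype σ s) (M₁.stype σ x) := by
        rcases hu with hu | hu
        · exact hu ▸ h₁
        · exact diaSub_trans htr hu.2 h₁
      rcases hw with hw | hw
      · exact hw ▸ h₂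
      · exact diaSub_trans htr h₂ hw.1
    exact hdis (Or.inl rfl : BlockEquiv (M₁.stype σ s) (M₁.stype σ s))
      (Or.inr ⟨hts, diaSub_of_rel hst⟩)

end Transfer

/-- the bijective, order- and definability-preserving correspondence between
the σ-blocks of two σ-bisimilar rooted models (Lemma `bis-blocks`). -/
theorem sblock_correspondence (W₁ W₂ : Type) (M₁ : KModel W₁) (M₂ : KModel W₂)
    (hM₁ : M₁.IsModel) (hM₂ : M₂.IsModel) (x₁ : W₁) (x₂ : W₂)
    (hr₁ : M₁.F.Rooted x₁) (hr₂ : M₂.F.Rooted x₂)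
    (hd₁ : M₁.F.Descriptive) (hd₂ : M₂.F.Descriptive)
    (hfg₁ : M₁.FinMGenerated) (hfg₂ : M₂.FinMGenerated)
    (hK₁ : M₁.F.IsFrameFor K43) (hK₂ : M₂.F.IsFrameFor K43)
    (σ : Set ℕ) (hbis : Bisimilar σ M₁ x₁ M₂ x₂) :
    (∀ b : Set W₁, M₁.IsSBlock σ b →
      {t : Set MF | ∃ z ∈ b, t = M₁.stype σ z} =
        {t : Set MF | ∃ z ∈ blockImage σ M₁ M₂ b, t = M₂.stype σ z}) ∧
    (∀ b : Set W₁, M₁.IsSBlock σ b →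
      M₂.IsSBlock σ (blockImage σ M₁ M₂ b) ∧
      (M₁.DegenSBlock σ b ↔ M₂.DegenSBlock σ (blockImage σ M₁ M₂ b))) ∧
    ((∀ y : W₂, ∃ b : Set W₁, M₁.IsSBlock σ b ∧ y ∈ blockImage σ M₁ M₂ b) ∧
     (∀ b b' : Set W₁, M₁.IsSBlock σ b → M₁.IsSBlock σ b' →
        (blockImage σ M₁ M₂ b ∩ blockImage σ M₁ M₂ b').Nonempty →
        blockImage σ M₁ M₂ b = blockImage σ M₁ M₂ b')) ∧
    (∀ b b' : Set W₁, M₁.IsSBlock σ b → M₁.IsSBlock σ b' →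
      (SetBefore M₁.F b b' ↔ SetBefore M₂.F (blockImage σ M₁ M₂ b) (blockImage σ M₁ M₂ b'))) ∧
    (∀ b : Set W₁, M₁.IsSBlock σ b →
      (M₁.Definable b ↔ M₂.Definable (blockImage σ M₁ M₂ b))) := by
  obtain ⟨β, hβ, hβr⟩ := hbis
  have htr₁ : ∀ x y z, M₁.F.R x y → M₁.F.R y z → M₁.F.R x z := fun _ _ _ =>
    KFrame.trans_of_isFrameFor_K43 hM₁.1 hd₁ hK₁
  have htr₂ : ∀ x y z, M₂.F.R x y → M₂.F.R y z → M₂.F.R x z := fun _ _ _ =>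
    KFrame.trans_of_isFrameFor_K43 hM₂.1 hd₂ hK₂
  have hconn₁ := hr₁.connected hM₁.1 hd₁ hK₁
  have hconn₂ := hr₂.connected hM₂.1 hd₂ hK₂
  have h₁₂ : ∀ x, ∃ y, M₂.stype σ y = M₁.stype σ x := by
    intro x
    rcases hr₁ x with rfl | hx
    · exact ⟨x₂, (hβ.stype_eq hβr).symm⟩
    · obtain ⟨y, -, hy⟩ := (hβ _ _ hβr).2.1 x hx
      exact ⟨y, (hβ.stype_eq hy).symm⟩
  have h₂₁ : ∀ y, ∃ x, M₁.stype σ x = M₂.stype σ y := by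
    intro y
    rcases hr₂ y with rfl | hy
    · exact ⟨x₁, hβ.stype_eq hβr⟩
    · obtain ⟨x, -, hx⟩ := (hβ _ _ hβr).2.2 y hy
      exact ⟨x, hβ.stype_eq hx⟩
  have hb₁ := KModel.sblockOf_eq (σ := σ) htr₁ hconn₁
  have hb₂ := KModel.sblockOf_eq (σ := σ) htr₂ hconn₂
  have himg : ∀ x, blockImage σ M₁ M₂ (M₁.sblockOf σ x) =
      {y | BlockEquiv (M₂.stype σ y) (M₁.stype σ x)} := by
    intro x
    rw [hb₁]
    ext y
    constructor
    · rintro ⟨z, hz, hyz⟩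
      rwa [Set.mem_ofPred_eq, hyz]
    · intro hy
      obtain ⟨z, hz⟩ := h₂₁ y
      exact ⟨z, by rwa [Set.mem_ofPred_eq, hz], hz.symm⟩
  refine ⟨?_, ?_, ⟨?_, ?_⟩, ?_, ?_⟩
  · rintro b -
    ext t
    constructor
    · rintro ⟨z, hz, rfl⟩
      obtain ⟨y, hy⟩ := h₁₂ z
      exact ⟨y, ⟨z, hz, hy⟩, hy.symm⟩
    · rintro ⟨y, ⟨z, hz, hy⟩, rfl⟩
      exact ⟨z, hz, hy⟩
  · rintro _ ⟨x, rfl⟩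
    obtain ⟨y, hy⟩ := h₁₂ x
    have heq : blockImage σ M₁ M₂ (M₁.sblockOf σ x) = M₂.sblockOf σ y := by
      rw [himg, hb₂, hy]
    refine ⟨⟨y, heq⟩, ?_, ?_⟩
    · rintro ⟨z, hz, hdeg⟩
      obtain ⟨w, hw⟩ := h₁₂ z
      refine ⟨w, by rw [hz, himg, hb₂, hw], ?_⟩
      change ¬ DiaSub (M₂.stype σ w) (M₂.stype σ w)
      rwa [hw]
    · rintro ⟨w, hw, hdeg⟩
      obtain ⟨z, hz⟩ := h₂₁ w
      refine ⟨z, ?_, ?_⟩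
      · have hmem : w ∈ M₂.sblockOf σ w := by
          rw [hb₂]
          exact Or.inl rfl
        rw [← hw] at hmem
        obtain ⟨u, hu, huw⟩ := hmem
        rcases hu with ⟨hxx, hux, hxu⟩ | ⟨-, rfl⟩
        · refine absurd ?_ hdeg
          change DiaSub (M₂.stype σ w) (M₂.stype σ w)
          rw [huw]
          exact KModel.diaSub_trans htr₁ hux hxu
        · rw [hb₁, hb₁, hz, huw]
      · change ¬ DiaSub (M₁.stype σ z) (M₁.stype σ z)
        rwa [hz]
  · intro y
    obtain ⟨x, hx⟩ := h₂₁ y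
    refine ⟨_, ⟨x, rfl⟩, ?_⟩
    rw [himg]
    exact Or.inl hx.symm
  · rintro _ _ ⟨x, rfl⟩ ⟨x', rfl⟩ ⟨y, hy, hy'⟩
    rw [himg] at hy hy' ⊢
    rw [himg]
    obtain ⟨u, hu⟩ := h₁₂ x
    obtain ⟨u', hu'⟩ := h₁₂ x'
    rw [← hu] at hy ⊢
    rw [← hu'] at hy' ⊢
    exact KModel.setOf_blockEquiv_eq htr₂ hy hy'
  · rintro _ _ ⟨x, rfl⟩ ⟨x', rfl⟩
    rw [himg, himg, hb₁, hb₁]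
    refine ⟨setBefore_transfer h₂₁ htr₁ hconn₂, ?_⟩
    obtain ⟨u, hu⟩ := h₁₂ x
    obtain ⟨u', hu'⟩ := h₁₂ x'
    rw [← hu, ← hu']
    exact setBefore_transfer h₁₂ htr₂ hconn₁
  · rintro _ ⟨x, rfl⟩
    rw [himg, hb₁]
    exact ⟨definable_transfer hM₁ hd₁ h₂₁ {t | BlockEquiv t (M₁.stype σ x)},
      definable_transfer hM₂ hd₂ h₁₂ {t | BlockEquiv t (M₁.stype σ x)}⟩
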